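/- Let W be a fixed k-dimensional subspace of an n-dimensional 𝔽_q-vector space V, and let d ≤ k. The number of linear transformations T : W → V whose maximal invariant subspace has dimension d and whose restriction to it lies in a fixed conjugacy class 𝒞(ℐ) of operators on a d-dimensional space equals [k choose d]_q · |𝒞(ℐ)| · ∏_{i=d+1}^{k} (q^n − q^i). -/

import Mathlib

open Submodule

section Defs
variable {K V : Type*} [Field K] [AddCommGroup V] [Module K V]

/-- The chain of subspaces `W₀ = V`, `W₁ = W`, `W_{i+1} = {v ∈ W_i : T v ∈ W_i}`. -/
def subChain (W : Submodule K V) (T : ↥W →ₗ[K] V) : ℕ → Submodule K V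
  | 0 => ⊤
  | 1 => W
  | (i+2) => subChain W T (i+1) ⊓ Submodule.map W.subtype ((subChain W T (i+1)).comap T)

theorem subChain_le (W : Submodule K V) (T : ↥W →ₗ[K] V) : ∀ k, subChain W T (k+1) ≤ W := by
  intro k
  induction k with
  | zero => simp [subChain]
  | succ k ih =>
      have h : subChain W T (k+2) ≤ subChain W T (k+1) := by
        rw [subChain]; exact inf_le_left
      exact le_trans h ih

/-- The `j`-th defect dimension `λ_{j+1} = dim W_j − dim W_{j+1}` (0-indexed). -/
noncomputable def defect (W : Submodule K V) (T : ↥W →ₗ[K] V) (j : ℕ) : ℕ :=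
  Module.finrank K (subChain W T j) - Module.finrank K (subChain W T (j+1))

/-- `U` is a `T`-invariant subspace of the domain `W`. -/
def TInv (W : Submodule K V) (T : ↥W →ₗ[K] V) (U : Submodule K V) : Prop :=
  U ≤ W ∧ ∀ v : ↥W, (v : V) ∈ U → T v ∈ U

/-- `T` is simple: its only invariant subspace is zero. -/
def SimpleMap (W : Submodule K V) (T : ↥W →ₗ[K] V) : Prop :=
  ∀ U : Submodule K V, TInv W T U → U = ⊥

/-- Similarity of linear maps defined on subspaces of `V`. -/
def SimilarMap (W W' : Submodule K V) (T : ↥W →ₗ[K] V) (T' : ↥W' →ₗ[K] V) : Prop :=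
  ∃ S : V ≃ₗ[K] V, W.map (S : V →ₗ[K] V) = W' ∧
    ∀ (v : ↥W) (hv : S (v : V) ∈ W'), S (T v) = T' ⟨S (v : V), hv⟩

/-- Gaussian binomial coefficient via the `q`-Pascal recurrence. -/
def qBinom (q : ℕ) : ℕ → ℕ → ℕ
  | _, 0 => 1
  | 0, _+1 => 0
  | n+1, k+1 => qBinom q n k + q ^ (k+1) * qBinom q n (k+1)

/-- Gaussian multinomial coefficient. -/
def qMultinom (q : ℕ) : List ℕ → ℕ
  | [] => 1
  | a :: l => qBinom q (a + l.sum) a * qMultinom q l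

/-- `γ_q(m) = ∏_{i=0}^{m−1}(q^m − q^i)`, the order of `GL_m(𝔽_q)`. -/
def gammaq (q m : ℕ) : ℕ := ∏ i ∈ Finset.range m, (q ^ m - q ^ i)

/-- `f` encodes a partition of `n`: `f i` is the `(i+1)`-st part. -/
def IsPartition (n : ℕ) (f : ℕ → ℕ) : Prop :=
  Antitone f ∧ (∀ i, n ≤ i → f i = 0) ∧ ∑ i ∈ Finset.range n, f i = n

end Defs
theorem qBinom_mul_prod (q : ℕ) : ∀ (k d : ℕ),
    (qBinom q k d : ℚ) * ∏ i ∈ Finset.range d, ((q:ℚ) ^ d - (q:ℚ) ^ i)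
      = ∏ i ∈ Finset.range d, ((q:ℚ) ^ k - (q:ℚ) ^ i) := by
  have step : ∀ k d : ℕ, ∏ i ∈ Finset.range (d+1), ((q:ℚ) ^ (k+1) - (q:ℚ) ^ i)
      = ((q:ℚ)^(k+1) - 1) * (q:ℚ)^d * ∏ i ∈ Finset.range d, ((q:ℚ) ^ k - (q:ℚ) ^ i) := by
    intro k d
    rw [Finset.prod_range_succ']
    have : ∀ i ∈ Finset.range d, ((q:ℚ) ^ (k+1) - (q:ℚ) ^ (i+1)) = q * ((q:ℚ)^k - (q:ℚ)^i) := by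
      intro i _; ring
    rw [Finset.prod_congr rfl this, Finset.prod_mul_distrib]
    simp; ring
  intro k
  induction k with
  | zero =>
    intro d
    cases d with
    | zero => simp [qBinom]
    | succ d => simp [qBinom, Finset.prod_range_succ']
  | succ k ih =>
    intro d
    cases d with
    | zero => simp [qBinom]
    | succ d =>
      have h1 := ih d
      have h2 := ih (d+1)
      rw [Finset.prod_range_succ (fun i => ((q:ℚ) ^ k - (q:ℚ) ^ i))] at h2
      have h3 := step d d
      rw [step k d]
      simp only [qBinom]
      push_cast
      rw [add_mul, mul_assoc, h2, h3]
      linear_combination ((q:ℚ) ^ (d + 1) - 1) * (q:ℚ)^d * h1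

theorem qBinom_eq_zero (q : ℕ) : ∀ (k d : ℕ), k < d → qBinom q k d = 0 := by
  intro k
  induction k with
  | zero => intro d hd; cases d with
    | zero => omega
    | succ d => rfl
  | succ k ih => intro d hd; cases d with
    | zero => omega
    | succ d => simp [qBinom, ih d (by omega), ih (d+1) (by omega)]

theorem qprod_ne (q : ℕ) (hq : 1 < q) (d : ℕ) :
    ∏ i ∈ Finset.range d, ((q:ℚ) ^ d - (q:ℚ) ^ i) ≠ 0 := by
  rw [Finset.prod_ne_zero_iff]
  intro i hi
  have : (q:ℚ)^i < (q:ℚ)^d := pow_lt_pow_right₀ (by exact_mod_cast hq) (Finset.mem_range.1 hi)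
  linarith

/-- other Pascal rule -/
theorem qBinom_pascal (q : ℕ) (hq : 1 < q) (k d : ℕ) (hd : d ≤ k) :
    (qBinom q (k+1) (d+1) : ℚ) = qBinom q k (d+1) + (q:ℚ)^(k-d) * qBinom q k d := by
  apply mul_right_cancel₀ (qprod_ne q hq (d+1))
  have step : ∀ k d : ℕ, ∏ i ∈ Finset.range (d+1), ((q:ℚ) ^ (k+1) - (q:ℚ) ^ i)
      = ((q:ℚ)^(k+1) - 1) * (q:ℚ)^d * ∏ i ∈ Finset.range d, ((q:ℚ) ^ k - (q:ℚ) ^ i) := by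
    intro k d
    rw [Finset.prod_range_succ']
    have : ∀ i ∈ Finset.range d, ((q:ℚ) ^ (k+1) - (q:ℚ) ^ (i+1)) = q * ((q:ℚ)^k - (q:ℚ)^i) := by
      intro i _; ring
    rw [Finset.prod_congr rfl this, Finset.prod_mul_distrib]
    simp; ring
  rw [qBinom_mul_prod, add_mul, qBinom_mul_prod, step k d, Finset.prod_range_succ, step d d]
  have h1 := qBinom_mul_prod q k d
  obtain ⟨m, rfl⟩ := Nat.exists_eq_add_of_le hd
  rw [show d + m - d = m by omega]
  linear_combination -((q:ℚ)^m * ((q:ℚ) ^ (d + 1) - 1) * (q:ℚ)^d * h1)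

theorem q_identity (q : ℕ) (hq : 1 < q) : ∀ (k : ℕ) (x : ℚ),
    ∑ d ∈ Finset.range (k+1), (qBinom q k d : ℚ) * (q:ℚ)^(d*d) *
      ∏ i ∈ Finset.Ico (d+1) (k+1), (x - (q:ℚ)^i) = x^k := by
  have hq0 : (q:ℚ) ≠ 0 := by positivity
  intro k
  induction k with
  | zero => intro x; simp [qBinom]
  | succ k ih =>
    intro x
    have h1 : (x - (q:ℚ)^(k+1)) * x^k = ∑ d ∈ Finset.range (k+2), (qBinom q k d : ℚ) * (q:ℚ)^(d*d) *
      ∏ i ∈ Finset.Ico (d+1) (k+2), (x - (q:ℚ)^i) := by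
      rw [Finset.sum_range_succ, qBinom_eq_zero q k (k+1) (by omega), ← ih x, Finset.mul_sum]
      simp only [Nat.cast_zero, zero_mul, add_zero]
      apply Finset.sum_congr rfl
      intro d hd
      rw [Finset.prod_Ico_succ_top (b := k+1) (by simp at hd; omega)]
      ring
    have h2 : (q:ℚ)^(k+1) * x^k = ∑ d ∈ Finset.range (k+1), ((q:ℚ)^(k-d) * (qBinom q k d : ℚ)) * (q:ℚ)^((d+1)*(d+1)) *
      ∏ i ∈ Finset.Ico (d+1+1) (k+2), (x - (q:ℚ)^i) := by
      have := ih (x/q)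
      have e : (q:ℚ)^(k+1) * x^k = (q:ℚ)^(2*k+1) * (x/q)^k := by
        rw [div_pow]; field_simp; ring
      rw [e, ← this, Finset.mul_sum]
      apply Finset.sum_congr rfl
      intro d hd
      obtain ⟨m, rfl⟩ := Nat.exists_eq_add_of_le (show d ≤ k by simp at hd; omega)
      have : ∏ i ∈ Finset.Ico (d+1+1) (d+m+2), (x - (q:ℚ)^i)
          = (q:ℚ)^m * ∏ i ∈ Finset.Ico (d+1) (d+m+1), (x/q - (q:ℚ)^i) := by
        rw [← Finset.prod_Ico_add' (fun i => x - (q:ℚ)^i) (d+1) (d+m+1) 1]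
        have : ∀ i ∈ Finset.Ico (d+1) (d+m+1), x - (q:ℚ)^(i+1) = q * (x/q - (q:ℚ)^i) := by
          intro i _; field_simp; ring
        rw [Finset.prod_congr rfl this, Finset.prod_mul_distrib]
        simp [show d + m + 1 - (d+1) = m by omega]
      rw [this, show d + m - d = m by omega]
      ring
    have h3 : x^(k+1) = (x - (q:ℚ)^(k+1)) * x^k + (q:ℚ)^(k+1) * x^k := by ring
    rw [h3, h1, h2, Finset.sum_range_succ', Finset.sum_range_succ' (n := k+1)]
    conv_rhs => rw [add_right_comm, ← Finset.sum_add_distrib]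
    congr 1
    · apply Finset.sum_congr rfl
      intro d hd
      rw [qBinom_pascal q hq k d (by simp at hd; omega)]
      ring
    · cases k <;> simp [qBinom]

theorem q_identity' (q : ℕ) (hq : 1 < q) (e m : ℕ) (x : ℚ) :
    ∑ j ∈ Finset.range (m+1), (qBinom q m j : ℚ) * (q:ℚ)^((e+j)*j) *
      ∏ i ∈ Finset.Ico (e+j+1) (e+m+1), (x - (q:ℚ)^i) = x^m := by
  have hq0 : (q:ℚ) ≠ 0 := by positivity
  have := q_identity q hq m (x/q^e)
  have h : x^m = (q:ℚ)^(e*m) * (x/q^e)^m := by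
    rw [div_pow, ← pow_mul]; field_simp
  rw [h, ← this, Finset.mul_sum]
  apply Finset.sum_congr rfl
  intro j hj
  obtain ⟨l, rfl⟩ := Nat.exists_eq_add_of_le (show j ≤ m by simp at hj; omega)
  have : ∏ i ∈ Finset.Ico (e+j+1) (e+(j+l)+1), (x - (q:ℚ)^i)
      = (q:ℚ)^(e*l) * ∏ i ∈ Finset.Ico (j+1) (j+l+1), (x/q^e - (q:ℚ)^i) := by
    have h0 := Finset.prod_Ico_add' (fun i => x - (q:ℚ)^i) (j+1) (j+l+1) e
    rw [show e+j+1 = j+1+e by omega, show e+(j+l)+1 = j+l+1+e by omega, ← h0]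
    have : ∀ i ∈ Finset.Ico (j+1) (j+l+1), x - (q:ℚ)^(i+e) = q^e * (x/q^e - (q:ℚ)^i) := by
      intro i _; rw [pow_add]; field_simp
    rw [Finset.prod_congr rfl this, Finset.prod_mul_distrib]
    simp [show j + l + 1 - (j+1) = l by omega, pow_mul]
  rw [this]
  ring

section Counting
variable {F : Type*} [Field F] [Fintype F]

theorem card_ext {P Q X : Type*} [AddCommGroup P] [Module F P] [AddCommGroup Q] [Module F Q]
    [AddCommGroup X] [Module F X] [FiniteDimensional F P] [FiniteDimensional F Q]
    [FiniteDimensional F X] (i : P →ₗ[F] Q) (hi : Function.Injective i) (g : P →ₗ[F] X) :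
    Nat.card {T : Q →ₗ[F] X // T ∘ₗ i = g} =
      Fintype.card F ^ (Module.finrank F X * (Module.finrank F Q - Module.finrank F P)) := by
  obtain ⟨l, hl⟩ := LinearMap.exists_leftInverse_of_injective i (LinearMap.ker_eq_bot.2 hi)
  have hle : Module.finrank F P ≤ Module.finrank F Q := LinearMap.finrank_le_finrank_of_injective hi
  let φ : (Q →ₗ[F] X) →ₗ[F] (P →ₗ[F] X) := LinearMap.lcomp F X i
  have hφ : Function.Surjective φ := by
    intro g
    refine ⟨g ∘ₗ l, ?_⟩
    change (g ∘ₗ l) ∘ₗ i = g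
    rw [LinearMap.comp_assoc, hl, LinearMap.comp_id]
  have e : {T : Q →ₗ[F] X // T ∘ₗ i = g} ≃ LinearMap.ker φ :=
    { toFun := fun T => ⟨T.1 - g ∘ₗ l, by
        rw [LinearMap.mem_ker]
        change (T.1 - g ∘ₗ l) ∘ₗ i = 0
        rw [LinearMap.sub_comp, T.2, LinearMap.comp_assoc, hl, LinearMap.comp_id, sub_self]⟩
      invFun := fun T => ⟨T.1 + g ∘ₗ l, by
        have : T.1 ∘ₗ i = 0 := T.2
        rw [LinearMap.add_comp, this, LinearMap.comp_assoc, hl, LinearMap.comp_id, zero_add]⟩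
      left_inv := fun T => by ext; simp
      right_inv := fun T => by ext; simp }
  rw [Nat.card_congr e, Module.natCard_eq_pow_finrank (K := F), Nat.card_eq_fintype_card]
  congr 1
  have h1 := LinearMap.finrank_range_add_finrank_ker φ
  rw [LinearMap.range_eq_top.2 hφ, finrank_top, Module.finrank_linearMap,
    Module.finrank_linearMap] at h1
  rw [Nat.mul_sub, mul_comm _ (Module.finrank F Q), mul_comm _ (Module.finrank F P)]
  omega

theorem card_LI {X : Type*} [AddCommGroup X] [Module F X] [FiniteDimensional F X] (j : ℕ) 
    (hj : j ≤ Module.finrank F X) :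
    (Nat.card {s : Fin j → X // LinearIndependent F s} : ℚ) =
      ∏ i ∈ Finset.range j, ((Fintype.card F : ℚ) ^ (Module.finrank F X) - (Fintype.card F : ℚ)^i) := by
  have : Finite X := Module.finite_of_finite F
  have := Fintype.ofFinite X
  rw [card_linearIndependent hj, ← Fin.prod_univ_eq_prod_range (fun i => ((Fintype.card F : ℚ) ^ (Module.finrank F X) - (Fintype.card F : ℚ)^i))]
  push_cast
  apply Finset.prod_congr rfl
  intro i _
  rw [Nat.cast_sub (Nat.pow_le_pow_right Fintype.card_pos (by have := i.2; omega))]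
  push_cast; rfl

theorem card_subspaces {X : Type*} [AddCommGroup X] [Module F X] [FiniteDimensional F X] (j : ℕ) :
    Nat.card {Y : Submodule F X // Module.finrank F Y = j} =
      qBinom (Fintype.card F) (Module.finrank F X) j := by
  have : Finite X := Module.finite_of_finite F
  have hfs : Finite (Submodule F X) := Finite.of_injective (fun Y => (Y : Set X)) SetLike.coe_injective
  by_cases hj : j ≤ Module.finrank F X
  swap
  · rw [qBinom_eq_zero _ _ _ (by omega)]
    have : IsEmpty {Y : Submodule F X // Module.finrank F Y = j} := by
      constructor; rintro ⟨Y, hY⟩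
      have := Submodule.finrank_le Y
      omega
    simp
  have := Fintype.ofFinite {Y : Submodule F X // Module.finrank F Y = j}
  have key : Nat.card (Σ Y : {Y : Submodule F X // Module.finrank F Y = j},
      {s : Fin j → Y.1 // LinearIndependent F s}) = Nat.card {s : Fin j → X // LinearIndependent F s} := by
    refine Nat.card_eq_of_bijective
      (fun p => ⟨fun a => (p.2.1 a : X), p.2.2.map' p.1.1.subtype (by simp)⟩) ⟨?_, ?_⟩
    · rintro ⟨⟨Y, hY⟩, ⟨s, hs⟩⟩ ⟨⟨Y', hY'⟩, ⟨s', hs'⟩⟩ h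
      replace h : (fun a => (s a : X)) = fun a => (s' a : X) := congrArg Subtype.val h
      have sp : ∀ (Y : Submodule F X) (hY : Module.finrank F Y = j) (s : Fin j → X)
          (hsY : ∀ a, s a ∈ Y)
          (hs : LinearIndependent F s), Submodule.span F (Set.range s) = Y := by
        intro Y hY s hsY hs
        apply Submodule.eq_of_le_of_finrank_eq
        · rw [Submodule.span_le]; rintro _ ⟨a, rfl⟩; exact hsY a
        · rw [hY, finrank_span_eq_card hs, Fintype.card_fin]
      have this : Y = Y' := by
        rw [← sp Y hY (fun a => (s a : X)) (fun a => (s a).2) (hs.map' Y.subtype (by simp)),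
          ← sp Y' hY' (fun a => (s' a : X)) (fun a => (s' a).2) (hs'.map' Y'.subtype (by simp)), h]
      subst this
      have : s = s' := by ext a; exact congrFun h a
      subst this
      rfl
    · rintro ⟨s, hs⟩
      refine ⟨⟨⟨Submodule.span F (Set.range s), by rw [finrank_span_eq_card hs]; simp⟩,
        ⟨fun a => ⟨s a, Submodule.subset_span ⟨a, rfl⟩⟩, ?_⟩⟩, rfl⟩
      exact LinearIndependent.of_comp (Submodule.span F (Set.range s)).subtype hs
  have h2 : (Nat.card {Y : Submodule F X // Module.finrank F Y = j} : ℚ) * 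
      ∏ i ∈ Finset.range j, ((Fintype.card F : ℚ) ^ j - (Fintype.card F : ℚ)^i) = 
      ∏ i ∈ Finset.range j, ((Fintype.card F : ℚ) ^ (Module.finrank F X) - (Fintype.card F : ℚ)^i) := by
    rw [← card_LI j hj, ← key, Nat.card_sigma]
    push_cast
    have : ∀ Y : {Y : Submodule F X // Module.finrank F Y = j}, 
        (Nat.card {s : Fin j → Y.1 // LinearIndependent F s} : ℚ) = 
        ∏ i ∈ Finset.range j, ((Fintype.card F : ℚ) ^ j - (Fintype.card F : ℚ)^i) := by
      intro Y
      rw [card_LI j Y.2.ge, Y.2]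
    simp [this]
  rw [← qBinom_mul_prod (Fintype.card F) (Module.finrank F X) j] at h2
  exact_mod_cast mul_right_cancel₀ (qprod_ne (Fintype.card F) Fintype.one_lt_card j) h2

theorem card_between {V : Type*} [AddCommGroup V] [Module F V] [FiniteDimensional F V] 
    (U W : Submodule F V) (hU : U ≤ W) (j : ℕ) :
    Nat.card {Y : Submodule F V // (U ≤ Y ∧ Y ≤ W) ∧ Module.finrank F Y = Module.finrank F U + j} =
      qBinom (Fintype.card F) (Module.finrank F W - Module.finrank F U) j := by
  let U' : Submodule F W := U.comap W.subtype
  have hU' : Module.finrank F U' = Module.finrank F U := (Submodule.comapSubtypeEquivOfLe hU).finrank_eq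
  have hq : Module.finrank F (W ⧸ U') = Module.finrank F W - Module.finrank F U := by
    rw [Submodule.finrank_quotient, hU']
  rw [← hq, ← card_subspaces j]
  have hdim : ∀ Z : Submodule F (W ⧸ U'), Module.finrank F ((Z.comap U'.mkQ).map W.subtype) = 
      Module.finrank F U + Module.finrank F Z := by
    intro Z
    rw [Submodule.finrank_map_subtype_eq]
    have h1 := LinearMap.finrank_range_add_finrank_ker (U'.mkQ.domRestrict (Z.comap U'.mkQ))
    have hle : U' ≤ Z.comap U'.mkQ := by
      intro x hx
      have : U'.mkQ x = 0 := by simpa using hx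
      show U'.mkQ x ∈ Z
      rw [this]; exact Z.zero_mem
    rw [LinearMap.range_domRestrict, Submodule.map_comap_eq_of_surjective U'.mkQ_surjective,
      LinearMap.ker_domRestrict, Submodule.ker_mkQ,
      (Submodule.comapSubtypeEquivOfLe hle).finrank_eq, hU'] at h1
    omega
  symm
  refine Nat.card_eq_of_bijective (fun Z => ⟨(Z.1.comap U'.mkQ).map W.subtype, ⟨?_, ?_⟩, ?_⟩) ⟨?_, ?_⟩
  · intro x hx
    refine ⟨⟨x, hU hx⟩, ?_, rfl⟩
    have : U'.mkQ ⟨x, hU hx⟩ = 0 := by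
      simpa [U'] using hx
    show U'.mkQ ⟨x, hU hx⟩ ∈ Z.1
    rw [this]; exact Z.1.zero_mem
  · exact Submodule.map_subtype_le _ _
  · rw [hdim, Z.2]
  · rintro ⟨Z, hZ⟩ ⟨Z', hZ'⟩ h
    simp only [Subtype.mk.injEq] at h ⊢
    have := Submodule.map_injective_of_injective W.subtype_injective h
    exact Submodule.comap_injective_of_surjective U'.mkQ_surjective this
  · rintro ⟨Y, ⟨hUY, hYW⟩, hY⟩
    have e : (((Y.comap W.subtype).map U'.mkQ).comap U'.mkQ).map W.subtype = Y := by
      rw [Submodule.comap_map_mkQ, sup_eq_right.2 (Submodule.comap_mono hUY), Submodule.map_comap_subtype]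
      exact inf_eq_right.2 hYW
    refine ⟨⟨(Y.comap W.subtype).map U'.mkQ, ?_⟩, ?_⟩
    · have := hdim ((Y.comap W.subtype).map U'.mkQ)
      rw [e] at this
      omega
    · simp only [e]

end Counting

section MaxInv
variable {F V : Type*} [Field F] [AddCommGroup V] [Module F V]

theorem exists_maxInv (W : Submodule F V) (T : W →ₗ[F] V) :
    ∃ M : Submodule F V, TInv W T M ∧ ∀ U', TInv W T U' → U' ≤ M := by
  let M := sSup {U | TInv W T U}
  have hM : M ≤ (M.comap T).map W.subtype := by
    apply sSup_le
    intro U hU x hx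
    have : U ≤ M := le_sSup hU
    exact ⟨⟨x, hU.1 hx⟩, this (hU.2 ⟨x, hU.1 hx⟩ hx), rfl⟩
  refine ⟨M, ⟨hM.trans (Submodule.map_subtype_le _ _), ?_⟩, fun U' h => le_sSup h⟩
  intro v hv
  obtain ⟨w, hw, hwv⟩ := hM hv
  have : w = v := Subtype.ext hwv
  subst this
  exact hw

theorem exists_restr {W : Submodule F V} {T : W →ₗ[F] V} {U : Submodule F V} (h : TInv W T U) :
    ∃ B : U →ₗ[F] U, T ∘ₗ inclusion h.1 = U.subtype ∘ₗ B :=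
  ⟨(T ∘ₗ inclusion h.1).codRestrict U (fun u => h.2 _ u.2), by ext; rfl⟩

theorem tinv_of_restr {W : Submodule F V} {T : W →ₗ[F] V} {U : Submodule F V} (hU : U ≤ W)
    (B : U →ₗ[F] U) (h : T ∘ₗ inclusion hU = U.subtype ∘ₗ B) : TInv W T U := by
  refine ⟨hU, fun v hv => ?_⟩
  have : T v = B ⟨v, hv⟩ := LinearMap.congr_fun h ⟨v, hv⟩
  rw [this]; exact Subtype.prop _

/-- maps with maximal invariant subspace `U` and operator part `B`. -/
def EMaps (W U : Submodule F V) (hU : U ≤ W) (B : U →ₗ[F] U) : Type _ :=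
  {T : W →ₗ[F] V // T ∘ₗ inclusion hU = U.subtype ∘ₗ B ∧ ∀ U', TInv W T U' → U' ≤ U}

/-- pairs extending `(U, B)` -/
def Pairs (W U : Submodule F V) (B : U →ₗ[F] U) : Type _ :=
  Σ Y : {Y : Submodule F V // U ≤ Y ∧ Y ≤ W},
    {B' : Y.1 →ₗ[F] Y.1 // B' ∘ₗ inclusion Y.2.1 = inclusion Y.2.1 ∘ₗ B}

theorem sigma_bij (W U : Submodule F V) (hU : U ≤ W) (B : U →ₗ[F] U) :
    Nat.card (Σ s : Pairs W U B, EMaps W s.1.1 s.1.2.2 s.2.1) =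
      Nat.card {T : W →ₗ[F] V // T ∘ₗ inclusion hU = U.subtype ∘ₗ B} := by
  have surj : ∀ T : W →ₗ[F] V, T ∘ₗ inclusion hU = U.subtype ∘ₗ B →
      ∃ p : (Σ s : Pairs W U B, EMaps W s.1.1 s.1.2.2 s.2.1), p.2.1 = T := by
    intro T hT
    obtain ⟨M, hM, hM'⟩ := exists_maxInv W T
    obtain ⟨B', hB'⟩ := exists_restr hM
    have hUM := hM' U (tinv_of_restr hU B hT)
    have hc : B' ∘ₗ inclusion hUM = inclusion hUM ∘ₗ B := by
      ext u
      exact (LinearMap.congr_fun hB' ⟨u, hUM u.2⟩).symm.trans (LinearMap.congr_fun hT u)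
    exact ⟨⟨⟨⟨M, hUM, hM.1⟩, ⟨B', hc⟩⟩, ⟨T, hB', hM'⟩⟩, rfl⟩
  have hf : ∀ p : (Σ s : Pairs W U B, EMaps W s.1.1 s.1.2.2 s.2.1),
      p.2.1 ∘ₗ inclusion hU = U.subtype ∘ₗ B := by
    intro p
    obtain ⟨⟨⟨Y, hUY, hYW⟩, ⟨B', hB'⟩⟩, ⟨T, hT, hT'⟩⟩ := p
    ext u
    have h1 := LinearMap.congr_fun hT ⟨u, hUY u.2⟩
    have h2 := LinearMap.congr_fun hB' u
    have h3 := congrArg Subtype.val h2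
    exact h1.trans h3
  refine Nat.card_eq_of_bijective (fun p => ⟨p.2.1, hf p⟩) ⟨?_, ?_⟩
  · rintro ⟨⟨⟨Y, hUY, hYW⟩, ⟨B', hB'⟩⟩, ⟨T, hT, hT'⟩⟩ ⟨⟨⟨Y2, hUY2, hYW2⟩, ⟨B2, hB2⟩⟩, ⟨T2, hT2, hT2'⟩⟩ h
    replace h : T = T2 := congrArg Subtype.val h
    subst h
    have : Y = Y2 := le_antisymm (hT2' _ (tinv_of_restr _ _ hT)) (hT' _ (tinv_of_restr _ _ hT2))
    subst this
    have : B' = B2 := by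
      ext u
      exact LinearMap.congr_fun (hT.symm.trans hT2) u
    subst this
    rfl
  · rintro ⟨T, hT⟩
    obtain ⟨p, hp⟩ := surj T hT
    exact ⟨p, Subtype.ext hp⟩

variable [Fintype F] [FiniteDimensional F V]

theorem finite_sub : Finite (Submodule F V) := by
  have : Finite V := Module.finite_of_finite F
  exact Finite.of_injective (fun Y => (Y : Set V)) SetLike.coe_injective

theorem finite_hom (X Y : Type*) [AddCommGroup X] [AddCommGroup Y] [Module F X] [Module F Y]
    [FiniteDimensional F X] [FiniteDimensional F Y] : Finite (X →ₗ[F] Y) :=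
  Module.finite_of_finite F

theorem finite_pairs (W U : Submodule F V) (B : U →ₗ[F] U) : Finite (Pairs W U B) := by
  have := finite_sub (F := F) (V := V)
  have := fun Y : Submodule F V => finite_hom (F := F) Y Y
  unfold Pairs
  infer_instance

theorem finite_emaps (W U : Submodule F V) (hU : U ≤ W) (B : U →ₗ[F] U) :
    Finite (EMaps W U hU B) := by
  have := finite_hom (F := F) W V
  unfold EMaps
  infer_instance

theorem sum_pairs (W U : Submodule F V) (hU : U ≤ W) (B : U →ₗ[F] U) [Fintype (Pairs W U B)]
    (f : ℕ → ℚ) :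
    ∑ s : Pairs W U B, f (Module.finrank F s.1.1) =
    ∑ j ∈ Finset.range (Module.finrank F W - Module.finrank F U + 1),
      (qBinom (Fintype.card F) (Module.finrank F W - Module.finrank F U) j : ℚ) *
      (Fintype.card F : ℚ) ^ ((Module.finrank F U + j) * j) * f (Module.finrank F U + j) := by
  classical
  have := finite_sub (F := F) (V := V)
  have := fun Y : Submodule F V => finite_hom (F := F) Y Y
  have := Fintype.ofFinite {Y : Submodule F V // U ≤ Y ∧ Y ≤ W}
  have := fun Y : {Y : Submodule F V // U ≤ Y ∧ Y ≤ W} => Fintype.ofFinite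
    {B' : Y.1 →ₗ[F] Y.1 // B' ∘ₗ inclusion Y.2.1 = inclusion Y.2.1 ∘ₗ B}
  have h1 : ∑ s : Pairs W U B, f (Module.finrank F s.1.1) =
      ∑ Y : {Y : Submodule F V // U ≤ Y ∧ Y ≤ W},
        (Fintype.card F : ℚ) ^ (Module.finrank F Y.1 * (Module.finrank F Y.1 - Module.finrank F U))
          * f (Module.finrank F Y.1) := by
    have e : ∑ s : (Σ Y : {Y : Submodule F V // U ≤ Y ∧ Y ≤ W},
        {B' : Y.1 →ₗ[F] Y.1 // B' ∘ₗ inclusion Y.2.1 = inclusion Y.2.1 ∘ₗ B}),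
          f (Module.finrank F s.1.1) =
        ∑ Y : {Y : Submodule F V // U ≤ Y ∧ Y ≤ W},
          ∑ _B : {B' : Y.1 →ₗ[F] Y.1 // B' ∘ₗ inclusion Y.2.1 = inclusion Y.2.1 ∘ₗ B},
            f (Module.finrank F Y.1) := Fintype.sum_sigma _
    refine Eq.trans ?_ (e.trans ?_)
    · let E : Pairs W U B ≃ Σ Y : {Y : Submodule F V // U ≤ Y ∧ Y ≤ W},
          {B' : Y.1 →ₗ[F] Y.1 // B' ∘ₗ inclusion Y.2.1 = inclusion Y.2.1 ∘ₗ B} := Equiv.refl _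
      exact Fintype.sum_equiv E (fun s => f (Module.finrank F s.1.1))
        (fun s => f (Module.finrank F s.1.1)) (fun _ => rfl)
    · apply Finset.sum_congr rfl
      intro Y _
      have := card_ext (inclusion Y.2.1) (inclusion_injective Y.2.1) (inclusion Y.2.1 ∘ₗ B)
      rw [Nat.card_eq_fintype_card] at this
      rw [Finset.sum_const, nsmul_eq_mul, Finset.card_univ]
      congr 1
      exact_mod_cast this
  rw [h1, ← Finset.sum_fiberwise_of_maps_to (s := Finset.univ)
    (t := Finset.range (Module.finrank F W - Module.finrank F U + 1))
    (g := fun Y : {Y : Submodule F V // U ≤ Y ∧ Y ≤ W} => Module.finrank F Y.1 - Module.finrank F U)]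
  · apply Finset.sum_congr rfl
    intro j _
    have h2 : ∀ Y ∈ Finset.univ.filter (fun Y : {Y : Submodule F V // U ≤ Y ∧ Y ≤ W} =>
        Module.finrank F Y.1 - Module.finrank F U = j),
        (Fintype.card F : ℚ) ^ (Module.finrank F Y.1 * (Module.finrank F Y.1 - Module.finrank F U))
          * f (Module.finrank F Y.1) = (Fintype.card F : ℚ) ^ ((Module.finrank F U + j) * j) * f (Module.finrank F U + j) := by
      intro Y hY
      have hY := (Finset.mem_filter.1 hY).2
      have := Submodule.finrank_mono Y.2.1
      rw [hY, show Module.finrank F Y.1 = Module.finrank F U + j by omega]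
    rw [Finset.sum_congr rfl h2, Finset.sum_const, nsmul_eq_mul, mul_assoc]
    congr 2
    rw [← card_between U W hU j, ← Fintype.card_subtype, ← Nat.card_eq_fintype_card]
    refine Nat.card_congr ((Equiv.subtypeSubtypeEquivSubtypeInter (fun Y : Submodule F V => U ≤ Y ∧ Y ≤ W)
      (fun Y : Submodule F V => Module.finrank F Y - Module.finrank F U = j)).trans
      (Equiv.subtypeEquivRight ?_))
    intro Y
    constructor
    · rintro ⟨h, h'⟩
      have := Submodule.finrank_mono h.1
      exact ⟨h, by omega⟩
    · rintro ⟨h, h'⟩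
      exact ⟨h, by omega⟩
  · intro Y _
    have := Submodule.finrank_mono Y.2.2
    simp only [Finset.mem_range]
    omega

theorem card_emaps (W : Submodule F V) : ∀ (m : ℕ) (U : Submodule F V) (hU : U ≤ W) (B : U →ₗ[F] U),
    Module.finrank F W - Module.finrank F U = m → 
    (Nat.card (EMaps W U hU B) : ℚ) = 
      ∏ i ∈ Finset.Ico (Module.finrank F U + 1) (Module.finrank F W + 1), 
        ((Fintype.card F : ℚ) ^ (Module.finrank F V) - (Fintype.card F : ℚ) ^ i) := by
  classical
  intro m
  induction m using Nat.strong_induction_on with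
  | _ m ih =>
  intro U hU B hm
  have := finite_pairs W U B
  have := Fintype.ofFinite (Pairs W U B)
  have := fun s : Pairs W U B => finite_emaps W s.1.1 s.1.2.2 s.2.1
  have hle := Submodule.finrank_mono hU
  let f : ℕ → ℚ := fun d => ∏ i ∈ Finset.Ico (d + 1) (Module.finrank F W + 1), 
        ((Fintype.card F : ℚ) ^ (Module.finrank F V) - (Fintype.card F : ℚ) ^ i)
  have e1 : ∑ s : Pairs W U B, (Nat.card (EMaps W s.1.1 s.1.2.2 s.2.1) : ℚ) = 
      ∑ s : Pairs W U B, f (Module.finrank F s.1.1) := by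
    rw [sum_pairs W U hU B f]
    have h1 := sigma_bij W U hU B
    rw [Nat.card_sigma, card_ext (inclusion hU) (inclusion_injective hU)] at h1
    rw [← Nat.cast_sum, h1, hm]
    push_cast
    rw [pow_mul, ← q_identity' (Fintype.card F) Fintype.one_lt_card (Module.finrank F U) m]
    simp only [f]
    rw [show Module.finrank F U + m = Module.finrank F W by omega]
  let s0 : Pairs W U B := ⟨⟨U, le_rfl, hU⟩, ⟨B, by ext; rfl⟩⟩
  have e2 : ∀ s ∈ Finset.univ.erase s0, (Nat.card (EMaps W s.1.1 s.1.2.2 s.2.1) : ℚ) = f (Module.finrank F s.1.1) := by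
    rintro ⟨⟨Y, hUY, hYW⟩, ⟨B', hB'⟩⟩ hs
    have hs := (Finset.mem_erase.1 hs).1
    have hne : U ≠ Y := by
      rintro rfl
      apply hs
      have : B' = B := by
        ext u
        exact congrArg Subtype.val (LinearMap.congr_fun hB' u)
      subst this
      rfl
    have h1 := Submodule.finrank_lt_finrank_of_lt (lt_of_le_of_ne hUY hne)
    have h2 := Submodule.finrank_mono hYW
    exact ih (Module.finrank F W - Module.finrank F Y) (by omega) Y hYW B' rfl
  rw [← Finset.add_sum_erase _ _ (Finset.mem_univ s0), ← Finset.add_sum_erase _ _ (Finset.mem_univ s0),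
    Finset.sum_congr rfl e2] at e1
  exact add_right_cancel e1

end MaxInv

set_option maxHeartbeats 2000000

/-- the number of `T : W → V` whose maximal invariant subspace has dimension
`d` and whose operator part lies in the conjugacy class of a fixed operator `A` on a
`d`-dimensional space equals `[k choose d]_q · |𝒞(ℐ)| · ∏_{i=d+1}^{k}(q^n − q^i)`. -/
theorem card_maps_with_operator_class {F V : Type*} [Field F] [Fintype F] [AddCommGroup V]
    [Module F V] [FiniteDimensional F V] (q n k d : ℕ)
    (hq : Fintype.card F = q) (hn : Module.finrank F V = n)
    (W : Submodule F V) (hk : Module.finrank F ↥W = k) (hd : d ≤ k)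
    (A : (Fin d → F) →ₗ[F] (Fin d → F)) :
    Nat.card {T : ↥W →ₗ[F] V //
        ∃ U : Submodule F V,
          (TInv W T U ∧ ∀ U' : Submodule F V, TInv W T U' → U' ≤ U) ∧
          Module.finrank F ↥U = d ∧
          ∃ e : ↥U ≃ₗ[F] (Fin d → F),
            ∀ (v : ↥U) (hv : (v : V) ∈ W) (hTv : T ⟨(v : V), hv⟩ ∈ U),
              e ⟨T ⟨(v : V), hv⟩, hTv⟩ = A (e v)} =
      qBinom q k d *
        Nat.card {B : (Fin d → F) →ₗ[F] (Fin d → F) //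
          ∃ g : (Fin d → F) ≃ₗ[F] (Fin d → F), ∀ x, g (B x) = A (g x)} *
        ∏ i ∈ Finset.Icc (d + 1) k, (q ^ n - q ^ i) := by
  classical
  have := finite_sub (F := F) (V := V)
  have := fun Y : Submodule F V => finite_hom (F := F) Y Y
  have := fun (U : Submodule F V) hU B => finite_emaps W U hU B
  let Z := Σ U : {U : Submodule F V // (⊥ ≤ U ∧ U ≤ W) ∧ Module.finrank F U = Module.finrank F (⊥ : Submodule F V) + d},
    {B : U.1 →ₗ[F] U.1 // ∃ e : U.1 ≃ₗ[F] (Fin d → F), ∀ v, e (B v) = A (e v)}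
  have hZf : Finite Z := by unfold Z; infer_instance
  have hZF := Fintype.ofFinite Z
  have := Fintype.ofFinite {U : Submodule F V // (⊥ ≤ U ∧ U ≤ W) ∧ Module.finrank F U = Module.finrank F (⊥ : Submodule F V) + d}
  have hdim : ∀ U : Submodule F V, Module.finrank F U = Module.finrank F (⊥ : Submodule F V) + d ↔ Module.finrank F U = d := by
    intro U; simp
  have hZ : Nat.card Z = qBinom q k d * Nat.card {B : (Fin d → F) →ₗ[F] (Fin d → F) //
          ∃ g : (Fin d → F) ≃ₗ[F] (Fin d → F), ∀ x, g (B x) = A (g x)} := by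
    unfold Z
    rw [Nat.card_sigma]
    have : ∀ U : {U : Submodule F V // (⊥ ≤ U ∧ U ≤ W) ∧ Module.finrank F U = Module.finrank F (⊥ : Submodule F V) + d},
        Nat.card {B : U.1 →ₗ[F] U.1 // ∃ e : U.1 ≃ₗ[F] (Fin d → F), ∀ v, e (B v) = A (e v)} =
        Nat.card {B : (Fin d → F) →ₗ[F] (Fin d → F) //
          ∃ g : (Fin d → F) ≃ₗ[F] (Fin d → F), ∀ x, g (B x) = A (g x)} := by
      intro U
      let e0 : U.1 ≃ₗ[F] (Fin d → F) := LinearEquiv.ofFinrankEq _ _ (by rw [(hdim _).1 U.2.2]; simp)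
      refine Nat.card_congr (Equiv.subtypeEquiv e0.conj.toEquiv ?_)
      intro B
      constructor
      · rintro ⟨e, he⟩
        exact ⟨e0.symm.trans e, fun x => by simp [LinearEquiv.conj_apply, he]⟩
      · rintro ⟨g, hg⟩
        refine ⟨e0.trans g, fun v => ?_⟩
        have := hg (e0 v)
        simpa [LinearEquiv.conj_apply] using this
    simp only [this, Finset.sum_const, smul_eq_mul, Finset.card_univ]
    rw [← Nat.card_eq_fintype_card, card_between ⊥ W bot_le d]
    simp [hk, hq]
  have hkn : k ≤ n := by rw [← hk, ← hn]; exact Submodule.finrank_le W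
  have hE : ∀ z : Z, Nat.card (EMaps W z.1.1 z.1.2.1.2 z.2.1) = ∏ i ∈ Finset.Icc (d + 1) k, (q ^ n - q ^ i) := by
    rintro ⟨⟨U, ⟨h0, hU⟩, hUd⟩, ⟨B, hB⟩⟩
    change Nat.card (EMaps W U hU B) = _
    have h1 := card_emaps W _ U hU B rfl
    rw [(hdim _).1 hUd, hk, hn, hq] at h1
    have h2 : ((∏ i ∈ Finset.Icc (d + 1) k, (q ^ n - q ^ i) : ℕ) : ℚ) = ∏ i ∈ Finset.Ico (d+1) (k+1), ((q : ℚ) ^ n - (q : ℚ) ^ i) := by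
      rw [Nat.cast_prod]
      apply Finset.prod_congr
      · ext; simp
      · intro i hi
        have : i ≤ n := by simp at hi; omega
        rw [Nat.cast_sub (Nat.pow_le_pow_right (by rw [← hq]; exact Fintype.card_pos) this)]
        push_cast; rfl
    rw [← h2] at h1
    exact_mod_cast h1
  have hfin : Nat.card (Σ z : Z, EMaps W z.1.1 z.1.2.1.2 z.2.1) = 
      Nat.card Z * ∏ i ∈ Finset.Icc (d + 1) k, (q ^ n - q ^ i) := by
    rw [Nat.card_sigma]
    simp [hE]
  have surj : ∀ T : W →ₗ[F] V, (∃ U : Submodule F V,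
          (TInv W T U ∧ ∀ U' : Submodule F V, TInv W T U' → U' ≤ U) ∧
          Module.finrank F ↥U = d ∧
          ∃ e : ↥U ≃ₗ[F] (Fin d → F),
            ∀ (v : ↥U) (hv : (v : V) ∈ W) (hTv : T ⟨(v : V), hv⟩ ∈ U),
              e ⟨T ⟨(v : V), hv⟩, hTv⟩ = A (e v)) →
      ∃ p : (Σ z : Z, EMaps W z.1.1 z.1.2.1.2 z.2.1), p.2.1 = T := by
    rintro T ⟨U, ⟨hU, hU'⟩, hUd, e, he⟩
    obtain ⟨B, hB⟩ := exists_restr hU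
    have hB' : ∀ v, e (B v) = A (e v) := by
      intro v
      have h1 : B v = (⟨T ⟨(v : V), hU.1 v.2⟩, hU.2 _ v.2⟩ : U) :=
        Subtype.ext (LinearMap.congr_fun hB v).symm
      exact (congrArg e h1).trans (he v (hU.1 v.2) (hU.2 _ v.2))
    exact ⟨⟨⟨⟨U, ⟨bot_le, hU.1⟩, (hdim _).2 hUd⟩, ⟨B, e, hB'⟩⟩, ⟨T, hB, hU'⟩⟩, rfl⟩
  have hf : ∀ p : (Σ z : Z, EMaps W z.1.1 z.1.2.1.2 z.2.1),
      (∃ U : Submodule F V,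
          (TInv W p.2.1 U ∧ ∀ U' : Submodule F V, TInv W p.2.1 U' → U' ≤ U) ∧
          Module.finrank F ↥U = d ∧
          ∃ e : ↥U ≃ₗ[F] (Fin d → F),
            ∀ (v : ↥U) (hv : (v : V) ∈ W) (hTv : p.2.1 ⟨(v : V), hv⟩ ∈ U),
              e ⟨p.2.1 ⟨(v : V), hv⟩, hTv⟩ = A (e v)) := by
    intro p
    obtain ⟨⟨⟨U, ⟨-, hU⟩, hUd⟩, ⟨B, e, he⟩⟩, ⟨T, hT, hT'⟩⟩ := p
    refine ⟨U, ⟨tinv_of_restr hU B hT, hT'⟩, (hdim _).1 hUd, e, ?_⟩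
    intro v hv hTv
    have : (⟨T ⟨(v : V), hv⟩, hTv⟩ : U) = B v := Subtype.ext (LinearMap.congr_fun hT v)
    exact (congrArg e this).trans (he v)
  rw [← hZ, ← hfin]
  symm
  refine Nat.card_eq_of_bijective (fun p => ⟨p.2.1, hf p⟩) ⟨?_, ?_⟩
  · rintro ⟨⟨⟨Y, ⟨hUY, hYW⟩, hd1⟩, ⟨B', hB'⟩⟩, ⟨T, hT, hT'⟩⟩ ⟨⟨⟨Y2, ⟨hUY2, hYW2⟩, hd2⟩, ⟨B2, hB2⟩⟩, ⟨T2, hT2, hT2'⟩⟩ h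
    replace h : T = T2 := congrArg Subtype.val h
    subst h
    have : Y = Y2 := le_antisymm (hT2' _ (tinv_of_restr _ _ hT)) (hT' _ (tinv_of_restr _ _ hT2))
    subst this
    have : B' = B2 := by
      ext u
      exact LinearMap.congr_fun (hT.symm.trans hT2) u
    subst this
    rfl
  · intro T
    have h1 := surj T.1 T.2
    refine Exists.elim h1 ?_
    intro p hp
    refine Exists.intro p ?_
    exact Subtype.ext hp
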